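/- arXiv:1306.2392 — 3 statements merged into one kernel-verified Lean document; each statement's English description precedes it below -/
import Mathlib

section
/- Let ζ_n = 1/(2·√(4n²−1)) for n ≥ 1. Then for every natural number n ≥ 1 and every real x, ∫₀ˣ P̃_n(t) dt = ζ_{n+1}·P̃_{n+1}(x) − ζ_n·P̃_{n−1}(x), and for n = 0, ∫₀ˣ P̃_0(t) dt = ζ_1·P̃_1(x) + (1/2)·P̃_0(x), where P̃_n is the normalized shifted Legendre polynomial of degree n. -/
open Finset

/-- The normalized shifted Legendre polynomial of degree `n`:
`P̃_n(x) = √(2n+1) · Σ_{k=0}^{n} (−1)^{n+k} · C(n,k) · C(n+k,k) · x^k`. -/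
noncomputable def shiftedLegendre (n : ℕ) (x : ℝ) : ℝ :=
  Real.sqrt (2 * n + 1) *
    ∑ k ∈ Finset.range (n + 1),
      (-1 : ℝ) ^ (n + k) * (n.choose k : ℝ) * ((n + k).choose k : ℝ) * x ^ k

/-- `ζ_n = 1/(2·√(4n²−1))`. -/
noncomputable def zetaIRK (n : ℕ) : ℝ := 1 / (2 * Real.sqrt (4 * (n : ℝ) ^ 2 - 1))

theorem cast_choose_succ_right_mul (n k : ℕ) :
    (n.choose (k + 1) : ℝ) * (k + 1) = n.choose k * (n - k) := by
  rcases le_or_gt k n with h | h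
  · have := Nat.choose_succ_right_eq n k
    rw [← Nat.cast_sub h]
    exact_mod_cast this
  · simp [Nat.choose_eq_zero_of_lt h, Nat.choose_eq_zero_of_lt (h.trans (Nat.lt_succ_self k))]

theorem cast_choose_mul_succ (n k : ℕ) :
    (n.choose k : ℝ) * (n + 1) = (n + 1).choose k * (n + 1 - k) := by
  rcases le_or_gt k (n + 1) with h | h
  · have := Nat.choose_mul_succ_eq n k
    have e : (n + 1 - k : ℝ) = ((n + 1 - k : ℕ) : ℝ) := by
      push_cast [Nat.cast_sub h]; ring
    rw [e]
    exact_mod_cast this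
  · simp [Nat.choose_eq_zero_of_lt h, Nat.choose_eq_zero_of_lt ((Nat.lt_succ_self n).trans h)]

/-- Coefficient form, without signs, of the fact that `2 (2n + 1) P_n` is the derivative of
`P_{n+1} - P_{n-1}` for the unnormalized shifted Legendre polynomials, with `n = m + 1`. -/
theorem legendre_coeff_relation (m k : ℕ) :
    2 * (2 * (m : ℝ) + 3) * ((m + 1).choose k * (m + 1 + k).choose k) =
      (k + 1) * ((m + 2).choose (k + 1) * (m + 2 + (k + 1)).choose (k + 1) -
        m.choose (k + 1) * (m + (k + 1)).choose (k + 1)) := by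
  have hk : (k + 1 : ℝ) ≠ 0 := by positivity
  have hm : (m + 1 : ℝ) ≠ 0 := by positivity
  have hm' : (m + 2 : ℝ) ≠ 0 := by positivity
  have h₁ : ((m + 2).choose (k + 1) : ℝ) * (k + 1) = (m + 2) * (m + 1).choose k := by
    exact_mod_cast (Nat.add_one_mul_choose_eq (m + 1) k).symm
  have h₂ : ((m + 2 + (k + 1)).choose (k + 1) : ℝ) * (k + 1) =
      (m + k + 3) * (m + k + 2).choose k := by
    have := (Nat.add_one_mul_choose_eq (m + k + 2) k).symm
    rw [show m + 2 + (k + 1) = m + k + 2 + 1 by ring]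
    exact_mod_cast this
  have h₃ := cast_choose_mul_succ (m + 1 + k) k
  rw [show m + 1 + k + 1 = m + k + 2 by ring] at h₃
  have h₄ := cast_choose_succ_right_mul m k
  have h₅ := cast_choose_mul_succ m k
  have h₆ := cast_choose_succ_right_mul (m + 1 + k) k
  rw [show m + (k + 1) = m + 1 + k by ring]
  push_cast at h₃ h₆
  rw [← eq_div_iff hk] at h₁ h₂ h₄ h₆
  rw [← eq_div_iff hm] at h₅
  have h₃' : ((m + k + 2).choose k : ℝ) = (m + 1 + k).choose k * (m + k + 2) / (m + 2) := by
    rw [eq_div_iff hm']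
    linear_combination -h₃
  rw [h₁, h₂, h₃', h₄, h₅, h₆]
  field_simp
  ring

theorem zetaIRK_succ (n : ℕ) :
    zetaIRK (n + 1) = 1 / (2 * (√(2 * n + 1) * √(2 * n + 3))) := by
  rw [zetaIRK, ← Real.sqrt_mul (by positivity)]
  push_cast
  ring_nf

theorem integral_shiftedLegendre_eq_sum (n : ℕ) (x : ℝ) :
    ∫ t in (0:ℝ)..x, shiftedLegendre n t =
      √(2 * n + 1) * ∑ k ∈ Finset.range (n + 1),
        (-1 : ℝ) ^ (n + k) * (n.choose k : ℝ) * ((n + k).choose k : ℝ) *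
          (x ^ (k + 1) / (k + 1)) := by
  simp only [shiftedLegendre]
  rw [intervalIntegral.integral_const_mul, intervalIntegral.integral_finsetSum
    fun k _ => (Continuous.intervalIntegrable (by fun_prop) _ _)]
  simp [integral_pow]

theorem legendre_sum_relation (m : ℕ) (x : ℝ) :
    2 * (2 * (m : ℝ) + 3) * ∑ k ∈ Finset.range (m + 2),
        (-1 : ℝ) ^ (m + 1 + k) * ((m + 1).choose k : ℝ) * ((m + 1 + k).choose k : ℝ) *
          (x ^ (k + 1) / (k + 1)) =
      ∑ k ∈ Finset.range (m + 3),
        (-1 : ℝ) ^ (m + 2 + k) * ((m + 2).choose k : ℝ) * ((m + 2 + k).choose k : ℝ) * x ^ k -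
      ∑ k ∈ Finset.range (m + 1),
        (-1 : ℝ) ^ (m + k) * (m.choose k : ℝ) * ((m + k).choose k : ℝ) * x ^ k := by
  have extend : ∑ k ∈ Finset.range (m + 1),
        (-1 : ℝ) ^ (m + k) * (m.choose k : ℝ) * ((m + k).choose k : ℝ) * x ^ k =
      ∑ k ∈ Finset.range (m + 3),
        (-1 : ℝ) ^ (m + k) * (m.choose k : ℝ) * ((m + k).choose k : ℝ) * x ^ k := by
    rw [Finset.sum_range_succ _ (m + 2), Finset.sum_range_succ _ (m + 1)]
    simp [Nat.choose_eq_zero_of_lt]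
  rw [extend, ← Finset.sum_sub_distrib, Finset.sum_range_succ' _ (m + 2), Finset.mul_sum]
  have head :
      (-1 : ℝ) ^ (m + 2 + 0) * ((m + 2).choose 0 : ℝ) * ((m + 2 + 0).choose 0 : ℝ) * x ^ 0 -
      (-1 : ℝ) ^ (m + 0) * (m.choose 0 : ℝ) * ((m + 0).choose 0 : ℝ) * x ^ 0 = 0 := by
    simp [pow_add]
  rw [head, add_zero]
  refine Finset.sum_congr rfl fun k _ => ?_
  have hk : (k + 1 : ℝ) ≠ 0 := by positivity
  have h := legendre_coeff_relation m k
  field_simp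
  simp only [pow_add] at h ⊢
  linear_combination (-1 : ℝ) ^ m * (-1) * (-1) ^ k * x ^ k * x * h

/-- Integration formula for the normalized shifted Legendre polynomials:
for `n ≥ 1`, `∫₀ˣ P̃_n = ζ_{n+1}·P̃_{n+1}(x) − ζ_n·P̃_{n−1}(x)`, and
`∫₀ˣ P̃_0 = ζ_1·P̃_1(x) + (1/2)·P̃_0(x)`. -/
theorem shiftedLegendre_integral :
    (∀ n : ℕ, 1 ≤ n → ∀ x : ℝ,
        ∫ t in (0:ℝ)..x, shiftedLegendre n t =
          zetaIRK (n + 1) * shiftedLegendre (n + 1) x -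
            zetaIRK n * shiftedLegendre (n - 1) x) ∧
      (∀ x : ℝ,
        ∫ t in (0:ℝ)..x, shiftedLegendre 0 t =
          zetaIRK 1 * shiftedLegendre 1 x + (1 / 2) * shiftedLegendre 0 x) := by
  refine ⟨fun n hn x => ?_, fun x => ?_⟩
  · obtain ⟨m, rfl⟩ := Nat.exists_eq_add_of_le' hn
    have h := legendre_sum_relation m x
    rw [integral_shiftedLegendre_eq_sum, zetaIRK_succ, zetaIRK_succ, shiftedLegendre,
      shiftedLegendre, Nat.add_sub_cancel]
    push_cast
    rw [show (2 * ((m : ℝ) + 1) + 1) = 2 * m + 3 by ring,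
      show (2 * ((m : ℝ) + 1) + 3) = 2 * m + 5 by ring,
      show (2 * ((m : ℝ) + 1 + 1) + 1) = 2 * m + 5 by ring]
    have h₁ : √(2 * (m : ℝ) + 1) ≠ 0 := by positivity
    have h₃ : √(2 * (m : ℝ) + 3) ≠ 0 := by positivity
    have h₅ : √(2 * (m : ℝ) + 5) ≠ 0 := by positivity
    have hsq : √(2 * (m : ℝ) + 3) ^ 2 = 2 * m + 3 := Real.sq_sqrt (by positivity)
    generalize √(2 * (m : ℝ) + 1) = a at *
    generalize √(2 * (m : ℝ) + 3) = b at *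
    generalize √(2 * (m : ℝ) + 5) = c at *
    simp only [← hsq, ← mul_div_assoc] at h
    field_simp
    linear_combination h
  · have h₃ : √(3 : ℝ) ≠ 0 := by positivity
    rw [integral_shiftedLegendre_eq_sum, zetaIRK_succ]
    norm_num [shiftedLegendre, Finset.sum_range_succ]
    field_simp
    ring
end

section
/- Let m ≥ 1, let c₁,…,c_m and b₁,…,b_m be real numbers such that Σ_{i=1}^m b_i·p(c_i) = ∫₀¹ p(x) dx for every real polynomial p of degree at most 2m−2. Define the m×m matrix W by w_{ij} = P̃_{j−1}(c_i) and B = diag(b₁,…,b_m), where P̃_n is the normalized shifted Legendre polynomial of degree n. Then Wᵀ·B·W = I_m. -/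
open Finset Matrix

open scoped Polynomial

/-- The shifted Legendre polynomial with real coefficients, normalized by `L_n(0) = 1`. -/
noncomputable def realShiftedLegendre (n : ℕ) : ℝ[X] :=
  (Polynomial.shiftedLegendre n).map (Int.castRingHom ℝ)

lemma shiftedLegendre_eq_eval (n : ℕ) (x : ℝ) :
    shiftedLegendre n x = √(2 * n + 1) * ((-1) ^ n * (realShiftedLegendre n).eval x) := by
  simp only [shiftedLegendre, realShiftedLegendre, Polynomial.shiftedLegendre,
    Polynomial.map_sum, Polynomial.eval_finsetSum, Finset.mul_sum]
  refine Finset.sum_congr rfl fun k _ => ?_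
  rw [Nat.choose_symm_add]
  simp only [Polynomial.map_mul, Polynomial.map_C, Polynomial.map_pow, Polynomial.map_X,
    Polynomial.eval_mul, Polynomial.eval_C, Polynomial.eval_pow, Polynomial.eval_X, pow_add]
  rw [eq_intCast]
  push_cast
  ring

lemma intervalIntegrable_polynomial_eval (p : ℝ[X]) (a b : ℝ) :
    IntervalIntegrable (fun x => p.eval x) MeasureTheory.volume a b :=
  p.continuous.intervalIntegrable a b

lemma integral_eval_derivative (p : ℝ[X]) (a b : ℝ) :
    ∫ x in a..b, p.derivative.eval x = p.eval b - p.eval a :=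
  intervalIntegral.integral_eq_sub_of_hasDerivAt (fun x _ => p.hasDerivAt x)
    (intervalIntegrable_polynomial_eval _ a b)

lemma eval_iterate_derivative_eq_zero {f : ℝ[X]} {a : ℝ} {n j : ℕ}
    (hf : (Polynomial.X - Polynomial.C a) ^ n ∣ f) (hj : j < n) :
    (Polynomial.derivative^[j] f).eval a = 0 := by
  have h := Polynomial.pow_sub_dvd_iterate_derivative_of_pow_dvd j hf
  exact Polynomial.dvd_iff_isRoot.mp ((dvd_pow_self _ (by omega)).trans h)

/-- Repeated integration by parts against a polynomial with zeros of order `n` at both endpoints. -/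
lemma integral_mul_iterate_derivative_eq_zero {f : ℝ[X]} {a b : ℝ} {n : ℕ}
    (ha : (Polynomial.X - Polynomial.C a) ^ n ∣ f) (hb : (Polynomial.X - Polynomial.C b) ^ n ∣ f)
    {j : ℕ} (hj : j ≤ n) {q : ℝ[X]} (hq : Polynomial.derivative^[j] q = 0) :
    ∫ x in a..b, (q * Polynomial.derivative^[j] f).eval x = 0 := by
  induction j generalizing q with
  | zero =>
    obtain rfl : q = 0 := hq
    simp
  | succ j ih =>
    have hparts := integral_eval_derivative (q * Polynomial.derivative^[j] f) a b
    rw [Polynomial.derivative_mul] at hparts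
    simp only [Polynomial.eval_add] at hparts
    rw [intervalIntegral.integral_add (intervalIntegrable_polynomial_eval _ a b)
      (intervalIntegrable_polynomial_eval _ a b), ih (by omega) hq, Polynomial.eval_mul,
      Polynomial.eval_mul, eval_iterate_derivative_eq_zero ha hj,
      eval_iterate_derivative_eq_zero hb hj] at hparts
    rw [Function.iterate_succ_apply']
    simpa using hparts

lemma factorial_mul_realShiftedLegendre (n : ℕ) :
    (n.factorial : ℝ[X]) * realShiftedLegendre n =
      Polynomial.derivative^[n] (Polynomial.X ^ n * (1 - Polynomial.X) ^ n) := by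
  have h := congrArg (Polynomial.map (Int.castRingHom ℝ))
    (Polynomial.factorial_mul_shiftedLegendre_eq n)
  simpa [← Polynomial.iterate_derivative_map, realShiftedLegendre] using h

/-- `L_n` is orthogonal to all polynomials of degree less than `n`. -/
lemma integral_mul_realShiftedLegendre_eq_zero {n : ℕ} {q : ℝ[X]} (hq : q.degree < n) :
    ∫ x in (0 : ℝ)..1, (q * realShiftedLegendre n).eval x = 0 := by
  have h := integral_mul_iterate_derivative_eq_zero (a := 0) (b := 1) (n := n)
    (f := Polynomial.X ^ n * (1 - Polynomial.X) ^ n) (by simp)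
    (Dvd.dvd.mul_left (pow_dvd_pow_of_dvd ⟨-1, by simp⟩ n) _) le_rfl
    (Polynomial.iterate_derivative_eq_zero_of_degree_lt hq)
  rw [← factorial_mul_realShiftedLegendre] at h
  simp only [Polynomial.eval_mul, Polynomial.eval_natCast, mul_left_comm (Polynomial.eval _ q),
    intervalIntegral.integral_const_mul] at h ⊢
  exact (mul_eq_zero.mp h).resolve_left (by positivity)

lemma degree_realShiftedLegendre (n : ℕ) : (realShiftedLegendre n).degree = n := by
  rw [realShiftedLegendre, Polynomial.degree_map_eq_of_injective Int.cast_injective,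
    Polynomial.degree_shiftedLegendre]

lemma natDegree_realShiftedLegendre (n : ℕ) : (realShiftedLegendre n).natDegree = n :=
  Polynomial.natDegree_eq_of_degree_eq_some (degree_realShiftedLegendre n)

lemma eval_one_realShiftedLegendre (n : ℕ) : (realShiftedLegendre n).eval 1 = (-1) ^ n := by
  have h := Polynomial.shiftedLegendre_eval_symm n (1 : ℝ)
  rw [sub_self, Polynomial.aeval_def, Polynomial.aeval_def, ← Polynomial.eval_map,
    ← Polynomial.eval_map, ← Polynomial.coeff_zero_eq_eval_zero, Polynomial.coeff_map,
    Polynomial.coeff_shiftedLegendre] at h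
  simpa [realShiftedLegendre] using h

/-- The Euler operator acts on a polynomial of degree at most `n` as multiplication by `n`,
up to terms of lower degree. -/
lemma degree_X_mul_derivative_sub_lt {p : ℝ[X]} {n : ℕ} (hp : p.degree ≤ n) :
    (Polynomial.X * p.derivative - (n : ℝ[X]) * p).degree < (n : WithBot ℕ) := by
  rw [Polynomial.degree_lt_iff_coeff_zero]
  intro k hk
  have hcoeff : (Polynomial.X * p.derivative).coeff k = k * p.coeff k := by
    cases k with
    | zero => simp
    | succ k => rw [Polynomial.coeff_X_mul, Polynomial.coeff_derivative]; push_cast; ring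
  rw [Polynomial.coeff_sub, hcoeff, Polynomial.coeff_natCast_mul]
  rcases hk.eq_or_lt with rfl | hlt
  · ring
  · rw [Polynomial.coeff_eq_zero_of_degree_lt (hp.trans_lt (by exact_mod_cast hlt))]
    ring

lemma integral_realShiftedLegendre_mul_self (n : ℕ) :
    (2 * n + 1) * ∫ x in (0 : ℝ)..1, (realShiftedLegendre n * realShiftedLegendre n).eval x
      = 1 := by
  set L := realShiftedLegendre n with hL
  set r := Polynomial.X * L.derivative - (n : ℝ[X]) * L with hr
  have horth : ∫ x in (0 : ℝ)..1, (r * L).eval x = 0 :=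
    integral_mul_realShiftedLegendre_eq_zero
      (degree_X_mul_derivative_sub_lt (degree_realShiftedLegendre n).le)
  have hder : (Polynomial.X * (L * L)).derivative =
      Polynomial.C (2 * n + 1 : ℝ) * (L * L) + Polynomial.C 2 * (r * L) := by
    simp only [Polynomial.derivative_mul, Polynomial.derivative_X, hr, map_add, map_mul,
      Polynomial.C_ofNat, map_natCast, map_one]
    ring
  have hftc := integral_eval_derivative (Polynomial.X * (L * L)) 0 1
  rw [hder] at hftc
  simp only [Polynomial.eval_add, Polynomial.eval_C_mul] at hftc
  rw [intervalIntegral.integral_add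
      ((intervalIntegrable_polynomial_eval _ 0 1).const_mul _)
      ((intervalIntegrable_polynomial_eval _ 0 1).const_mul _),
    intervalIntegral.integral_const_mul, intervalIntegral.integral_const_mul, horth] at hftc
  simpa [hL, eval_one_realShiftedLegendre, ← mul_pow] using hftc

lemma integral_realShiftedLegendre_mul_eq_zero {j k : ℕ} (hjk : j ≠ k) :
    ∫ x in (0 : ℝ)..1, (realShiftedLegendre j * realShiftedLegendre k).eval x = 0 := by
  rcases hjk.lt_or_gt with h | h
  · exact integral_mul_realShiftedLegendre_eq_zero
      (by rw [degree_realShiftedLegendre]; exact_mod_cast h)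
  · rw [mul_comm]
    exact integral_mul_realShiftedLegendre_eq_zero
      (by rw [degree_realShiftedLegendre]; exact_mod_cast h)

/-- If `(b_i, c_i)` is a quadrature rule on `[0,1]` exact for polynomials of degree
`≤ 2m−2`, then `Wᵀ·B·W = I` with `w_{ij} = P̃_{j−1}(c_i)` and `B = diag(b)`. -/
theorem wTransformation_WtBW_eq_one (m : ℕ) (hm : 1 ≤ m) (c b : Fin m → ℝ)
    (hquad : ∀ p : Polynomial ℝ, p.natDegree ≤ 2 * m - 2 →
      ∑ i, b i * p.eval (c i) = ∫ x in (0:ℝ)..1, p.eval x) :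
    (Matrix.of fun i j : Fin m => shiftedLegendre (j : ℕ) (c i))ᵀ *
        Matrix.diagonal b *
        (Matrix.of fun i j : Fin m => shiftedLegendre (j : ℕ) (c i)) =
      (1 : Matrix (Fin m) (Fin m) ℝ) := by
  ext j k
  have hdeg : (realShiftedLegendre j * realShiftedLegendre k).natDegree ≤ 2 * m - 2 := by
    refine Polynomial.natDegree_mul_le.trans ?_
    rw [natDegree_realShiftedLegendre, natDegree_realShiftedLegendre]
    omega
  have hentry : ((Matrix.of fun i j : Fin m => shiftedLegendre (j : ℕ) (c i))ᵀ *
        Matrix.diagonal b *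
        (Matrix.of fun i j : Fin m => shiftedLegendre (j : ℕ) (c i))) j k =
      √(2 * (j : ℕ) + 1) * (-1) ^ (j : ℕ) * (√(2 * (k : ℕ) + 1) * (-1) ^ (k : ℕ)) *
        ∑ i, b i * (realShiftedLegendre j * realShiftedLegendre k).eval (c i) := by
    rw [Matrix.mul_apply, Finset.mul_sum]
    refine Finset.sum_congr rfl fun i _ => ?_
    simp only [Matrix.mul_diagonal, Matrix.transpose_apply, Matrix.of_apply,
      shiftedLegendre_eq_eval, Polynomial.eval_mul]
    ring
  rw [hentry, hquad _ hdeg]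
  rcases eq_or_ne j k with rfl | hjk
  · rw [mul_mul_mul_comm, Real.mul_self_sqrt (by positivity), ← mul_pow, Matrix.one_apply_eq]
    simpa using integral_realShiftedLegendre_mul_self j
  · rw [integral_realShiftedLegendre_mul_eq_zero (Fin.val_ne_of_ne hjk), mul_zero,
      Matrix.one_apply_ne hjk]
end

section
/- Let C be an invertible n×n real matrix, d ∈ ℝⁿ, and 0 ≤ ε < 1. Let (x_k) be a sequence in ℝⁿ with residuals r_k = d − C·x_k such that for every k: either r_k = 0 and x_{k+1} = x_k, or x_{k+1} = x_k + ‖r_k‖·z_k for some z_k with ‖C·z_k − r_k/‖r_k‖‖ ≤ ε. Then ‖r_k‖ ≤ ε^k·‖r₀‖ for all k, and consequently x_k converges to C⁻¹·d as k → ∞. -/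
open Matrix Filter

/-- One refinement step contracts the residual by the factor `ε`, in any norm. -/
theorem norm_residual_refine_le {E F : Type*} [AddCommGroup E] [Module ℝ E]
    [NormedAddCommGroup F] [NormedSpace ℝ F] (A : E →ₗ[ℝ] F) (d : F) (x z : E) {ε : ℝ}
    (hz : ‖A z - ‖d - A x‖⁻¹ • (d - A x)‖ ≤ ε) :
    ‖d - A (x + ‖d - A x‖ • z)‖ ≤ ε * ‖d - A x‖ := by
  have hnormalize : ‖d - A x‖ • ‖d - A x‖⁻¹ • (d - A x) = d - A x := by
    by_cases h : d - A x = 0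
    · simp [h]
    · exact smul_inv_smul₀ (norm_ne_zero_iff.mpr h) _
  have hres : d - A (x + ‖d - A x‖ • z) =
      -(‖d - A x‖ • (A z - ‖d - A x‖⁻¹ • (d - A x))) := by
    rw [smul_sub, hnormalize, map_add, map_smul]
    abel
  rw [hres, norm_neg, norm_smul, norm_norm, mul_comm]
  gcongr

/-- Linear convergence of the iterative refinement method: if every inner solve
has relative residual at most `ε < 1`, then `‖r_k‖ ≤ ε^k·‖r₀‖` and the iterates
converge to the true solution `C⁻¹·d`. -/
theorem iterative_refinement_convergence (n : ℕ)
    (C : Matrix (Fin n) (Fin n) ℝ) (hC : IsUnit C.det)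
    (d : Fin n → ℝ) (ε : ℝ) (hε0 : 0 ≤ ε) (hε1 : ε < 1)
    (x : ℕ → Fin n → ℝ) (r : ℕ → Fin n → ℝ)
    (hr : ∀ k, r k = d - C.mulVec (x k))
    (hstep : ∀ k, (r k = 0 ∧ x (k + 1) = x k) ∨
      ∃ z : Fin n → ℝ, ‖C.mulVec z - ‖r k‖⁻¹ • r k‖ ≤ ε ∧
        x (k + 1) = x k + ‖r k‖ • z) :
    (∀ k, ‖r k‖ ≤ ε ^ k * ‖r 0‖) ∧
      Tendsto x atTop (nhds (C⁻¹.mulVec d)) := by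
  have hcontract : ∀ k, ‖r (k + 1)‖ ≤ ε * ‖r k‖ := by
    intro k
    rcases hstep k with ⟨h0, hx⟩ | ⟨z, hz, hx⟩
    · have : r (k + 1) = 0 := by rw [hr, hx, ← hr, h0]
      simp [this, h0]
    · rw [hr (k + 1), hx]
      rw [hr k] at hz ⊢
      exact norm_residual_refine_le C.mulVecLin d (x k) z hz
  have hbound : ∀ k, ‖r k‖ ≤ ε ^ k * ‖r 0‖ := by
    intro k
    induction k with
    | zero => simp
    | succ k ih =>
      calc ‖r (k + 1)‖ ≤ ε * ‖r k‖ := hcontract k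
        _ ≤ ε * (ε ^ k * ‖r 0‖) := by gcongr
        _ = ε ^ (k + 1) * ‖r 0‖ := by ring
  refine ⟨hbound, ?_⟩
  have hr0 : Tendsto r atTop (nhds 0) :=
    squeeze_zero_norm hbound <| by
      simpa using (tendsto_pow_atTop_nhds_zero_of_lt_one hε0 hε1).mul_const ‖r 0‖
  have hx : x = fun k => C⁻¹ *ᵥ (d - r k) := by
    funext k
    rw [hr, sub_sub_cancel, mulVec_mulVec, nonsing_inv_mul C hC, one_mulVec]
  have hcont : Continuous fun v : Fin n → ℝ => C⁻¹ *ᵥ (d - v) := by fun_prop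
  rw [hx]
  simpa [Function.comp_def] using (hcont.tendsto 0).comp hr0
end
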